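/- arXiv:2603.19560 — 2 statements merged into one kernel-verified Lean document; each statement's English description precedes it below -/
import Mathlib

section
/- (Compatibility of Rule Composition) Let r₁, r₁′, r₂, r₂′ be functional rewrite rules with r₁ ≡ r₁′ and r₂ ≡ r₂′. If the composition r₁ ∘ r₂ equals a rule r and the composition r₁′ ∘ r₂′ equals a rule r′, then r ≡ r′. In particular, rule composition is well defined up to rule equivalence. -/
inductive Pattern (K X : Type) : Type
  | var : X → Pattern K X
  | con : K → List (Pattern K X) → Pattern K X

abbrev Subst (K X : Type) : Type := X → Pattern K X

def Pattern.subst {K X : Type} (σ : Subst K X) : Pattern K X → Pattern K X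
  | .var x => σ x
  | .con k ps => .con k (ps.attach.map fun q => Pattern.subst σ q.1)
termination_by p => sizeOf p
decreasing_by
  have := List.sizeOf_lt_of_mem q.2
  simp only [Pattern.con.sizeOf_spec]
  omega

def scomp {K X : Type} (σ₁ σ₂ : Subst K X) : Subst K X :=
  fun x => (σ₂ x).subst σ₁

def Factors {K X : Type} (σ₁ σ₂ : Subst K X) : Prop :=
  ∃ σ₃, σ₁ = scomp σ₃ σ₂

def Unifies {K X : Type} (σ₁ σ₂ : Subst K X) (p₁ p₂ : Pattern K X) : Prop :=
  p₁.subst σ₁ = p₂.subst σ₂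

def IsMGU {K X : Type} (σ₁ σ₂ : Subst K X) (p₁ p₂ : Pattern K X) : Prop :=
  Unifies σ₁ σ₂ p₁ p₂ ∧
  ∀ σ₁' σ₂' : Subst K X, Unifies σ₁' σ₂' p₁ p₂ → Factors σ₁' σ₁ ∧ Factors σ₂' σ₂

inductive IsGround {K X : Type} : Pattern K X → Prop
  | con (k : K) (ps : List (Pattern K X)) : (∀ p ∈ ps, IsGround p) → IsGround (.con k ps)

inductive VarOccurs {K X : Type} (x : X) : Pattern K X → Prop
  | var : VarOccurs x (.var x)
  | con (k : K) (ps : List (Pattern K X)) (p : Pattern K X) :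
      p ∈ ps → VarOccurs x p → VarOccurs x (.con k ps)

abbrev Rule (K X : Type) : Type := Pattern K X × Pattern K X

def Functional {K X : Type} (r : Rule K X) : Prop :=
  ∀ x, VarOccurs x r.2 → VarOccurs x r.1

def Step {K X : Type} (r : Rule K X) (t₁ t₂ : Pattern K X) : Prop :=
  ∃ σ : Subst K X, r.1.subst σ = t₁ ∧ r.2.subst σ = t₂

def ComposedBy {K X : Type} (r₁ r₂ r : Rule K X) : Prop :=
  ∃ σ₁ σ₂ : Subst K X, IsMGU σ₁ σ₂ r₁.2 r₂.1 ∧ r = (r₁.1.subst σ₁, r₂.2.subst σ₂)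

def RuleEquiv {K X : Type} (r r' : Rule K X) : Prop :=
  ∃ σ₁ σ₂ : Subst K X,
    r.1.subst σ₁ = r'.1 ∧ r.2.subst σ₁ = r'.2 ∧
    r'.1.subst σ₂ = r.1 ∧ r'.2.subst σ₂ = r.2

def StepSet {K X : Type} (R : Set (Rule K X)) (t₁ t₂ : Pattern K X) : Prop :=
  ∃ r ∈ R, Step r t₁ t₂

def Evaluates {K X : Type} (R : Set (Rule K X)) (t₁ t₂ : Pattern K X) : Prop :=
  Relation.ReflTransGen (StepSet R) t₁ t₂ ∧ ∀ t₃, ¬ StepSet R t₂ t₃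

theorem Pattern.subst_var {K X : Type} (σ : Subst K X) (x : X) :
    (Pattern.var x).subst σ = σ x := by
  rw [Pattern.subst]

theorem Pattern.subst_con {K X : Type} (σ : Subst K X) (k : K) (ps : List (Pattern K X)) :
    (Pattern.con k ps).subst σ = .con k (ps.map (Pattern.subst σ)) := by
  rw [Pattern.subst]
  simp

theorem Pattern.induction_mem {K X : Type} {P : Pattern K X → Prop}
    (var : ∀ x, P (.var x)) (con : ∀ k ps, (∀ p ∈ ps, P p) → P (.con k ps)) :
    ∀ p, P p
  | .var x => var x
  | .con k ps => con k ps fun q _ => Pattern.induction_mem var con q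
termination_by p => sizeOf p
decreasing_by
  have := List.sizeOf_lt_of_mem ‹q ∈ ps›
  simp only [Pattern.con.sizeOf_spec]
  omega

theorem Pattern.subst_scomp {K X : Type} (σ τ : Subst K X) (p : Pattern K X) :
    p.subst (scomp σ τ) = (p.subst τ).subst σ := by
  induction p using Pattern.induction_mem with
  | var x => simp only [Pattern.subst_var, scomp]
  | con k ps ih =>
    simp only [Pattern.subst_con, List.map_map]
    congr 1
    exact List.map_congr_left ih

theorem Pattern.subst_eq_subst_iff {K X : Type} (σ τ : Subst K X) (p : Pattern K X) :
    p.subst σ = p.subst τ ↔ ∀ x, VarOccurs x p → σ x = τ x := by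
  induction p using Pattern.induction_mem with
  | var x =>
    simp only [Pattern.subst_var]
    refine ⟨fun h y hy => ?_, fun h => h x .var⟩
    cases hy
    exact h
  | con k ps ih =>
    simp only [Pattern.subst_con, Pattern.con.injEq, true_and, List.map_inj_left]
    constructor
    · intro h x hx
      cases hx with
      | con _ _ p hp hxp => exact (ih p hp).1 (h p hp) x hxp
    · exact fun h p hp => (ih p hp).2 fun x hx => h x (.con k ps p hp hx)

/-- A composite of two rules, the second of them functional, maps by one substitution onto any
composite of substitution instances of the two rules. -/
theorem exists_subst_composite {K X : Type} {a b c d a' b' c' d' : Pattern K X}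
    {τ₁ τ₂ σ₁ σ₂ σ₁' σ₂' : Subst K X} (hf : Functional (c, d))
    (ha : a.subst τ₁ = a') (hb : b.subst τ₁ = b') (hc : c.subst τ₂ = c') (hd : d.subst τ₂ = d')
    (h : IsMGU σ₁ σ₂ b c) (h' : Unifies σ₁' σ₂' b' c') :
    ∃ σ : Subst K X, (a.subst σ₁).subst σ = a'.subst σ₁' ∧
      (d.subst σ₂).subst σ = d'.subst σ₂' := by
  subst ha hb hc hd
  have hu : Unifies (scomp σ₁' τ₁) (scomp σ₂' τ₂) b c := by
    simpa only [Unifies, Pattern.subst_scomp] using h'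
  obtain ⟨⟨σ, hσ⟩, ⟨ρ, hρ⟩⟩ := h.2 _ _ hu
  have hagree : c.subst (scomp σ σ₂) = c.subst (scomp ρ σ₂) := by
    rw [← hρ, ← hu, hσ, Pattern.subst_scomp, Pattern.subst_scomp, h.1]
  rw [Pattern.subst_eq_subst_iff] at hagree
  refine ⟨σ, ?_, ?_⟩
  · rw [← Pattern.subst_scomp, ← Pattern.subst_scomp, hσ]
  · rw [← Pattern.subst_scomp, ← Pattern.subst_scomp, hρ, Pattern.subst_eq_subst_iff]
    exact fun x hx => hagree x (hf x hx)

theorem rule_composition_compat {K X : Type} [Countable X] [Infinite X]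
    (r₁ r₁' r₂ r₂' : Rule K X)
    (hf₁ : Functional r₁) (hf₁' : Functional r₁')
    (hf₂ : Functional r₂) (hf₂' : Functional r₂')
    (he₁ : RuleEquiv r₁ r₁') (he₂ : RuleEquiv r₂ r₂')
    (r r' : Rule K X) (hc : ComposedBy r₁ r₂ r) (hc' : ComposedBy r₁' r₂' r') :
    RuleEquiv r r' := by
  obtain ⟨σ₁, σ₂, hm, rfl⟩ := hc
  obtain ⟨σ₁', σ₂', hm', rfl⟩ := hc'
  obtain ⟨τ₁, ρ₁, ha, hb, ha', hb'⟩ := he₁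
  obtain ⟨τ₂, ρ₂, hc, hd, hc', hd'⟩ := he₂
  obtain ⟨σ, hσ₁, hσ₂⟩ := exists_subst_composite hf₂ ha hb hc hd hm hm'.1
  obtain ⟨ρ, hρ₁, hρ₂⟩ := exists_subst_composite hf₂' ha' hb' hc' hd' hm' hm.1
  exact ⟨σ, ρ, hσ₁, hσ₂, hρ₁, hρ₂⟩
end

section
/- (Associativity of rule composition up to equivalence) Let r₁, r₂, r₃ be functional rewrite rules. If the compositions r₁ ∘ r₂, (r₁ ∘ r₂) ∘ r₃, r₂ ∘ r₃, and r₁ ∘ (r₂ ∘ r₃) all exist, then (r₁ ∘ r₂) ∘ r₃ ≡ r₁ ∘ (r₂ ∘ r₃). -/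
namespace Pattern

variable {K X : Type}

theorem subst_var_s8 (σ : Subst K X) (x : X) : (Pattern.var x).subst σ = σ x := by
  rw [Pattern.subst]

theorem subst_con_s8 (σ : Subst K X) (k : K) (ps : List (Pattern K X)) :
    (Pattern.con k ps).subst σ = .con k (ps.map (Pattern.subst σ)) := by
  rw [Pattern.subst, List.attach_map_val (f := Pattern.subst σ)]

theorem induction_mem_s8 {P : Pattern K X → Prop} (hvar : ∀ x, P (.var x))
    (hcon : ∀ k ps, (∀ p ∈ ps, P p) → P (.con k ps)) : ∀ p, P p
  | .var x => hvar x
  | .con k ps => hcon k ps fun p _ => induction_mem_s8 hvar hcon p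

theorem subst_scomp_s8 (σ τ : Subst K X) (p : Pattern K X) :
    p.subst (scomp σ τ) = (p.subst τ).subst σ := by
  induction p using induction_mem_s8 with
  | hvar x => simp only [subst_var_s8, scomp]
  | hcon k ps ih =>
    simp only [subst_con_s8, List.map_map, con.injEq, true_and]
    exact List.map_congr_left ih

theorem subst_id (p : Pattern K X) : p.subst Pattern.var = p := by
  induction p using induction_mem_s8 with
  | hvar x => exact subst_var_s8 _ x
  | hcon k ps ih =>
    rw [subst_con_s8, List.map_congr_left ih, List.map_id']

theorem subst_congr {σ τ : Subst K X} {p : Pattern K X}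
    (h : ∀ x, VarOccurs x p → σ x = τ x) : p.subst σ = p.subst τ := by
  induction p using induction_mem_s8 with
  | hvar x => simpa only [subst_var_s8] using h x .var
  | hcon k ps ih =>
    rw [subst_con_s8, subst_con_s8]
    exact congrArg _ (List.map_congr_left fun q hq => ih q hq fun x hx => h x (.con k ps q hq hx))

theorem eq_of_subst_eq {σ τ : Subst K X} {p : Pattern K X} {x : X}
    (hx : VarOccurs x p) (h : p.subst σ = p.subst τ) : σ x = τ x := by
  induction hx with
  | var => simpa only [subst_var_s8] using h
  | con k ps q hq _ ih =>
    simp only [subst_con_s8, con.injEq, true_and] at h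
    exact ih (List.map_inj_left.mp h q hq)

theorem varOccurs_subst_iff {σ : Subst K X} {y : X} {p : Pattern K X} :
    VarOccurs y (p.subst σ) ↔ ∃ x, VarOccurs x p ∧ VarOccurs y (σ x) := by
  constructor
  · intro h
    induction p using induction_mem_s8 with
    | hvar x => exact ⟨x, .var, by simpa only [subst_var_s8] using h⟩
    | hcon k ps ih =>
      rw [subst_con_s8] at h
      obtain _ | ⟨_, _, q, hq, hy⟩ := h
      obtain ⟨p, hp, rfl⟩ := List.mem_map.mp hq
      obtain ⟨x, hx, hyx⟩ := ih p hp hy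
      exact ⟨x, .con k ps p hp hx, hyx⟩
  · rintro ⟨x, hx, hy⟩
    induction hx with
    | var => rwa [subst_var_s8]
    | con k ps q hq _ ih =>
      rw [subst_con_s8]
      exact .con k _ _ (List.mem_map_of_mem hq) ih

end Pattern

theorem Functional.varOccurs_subst {K X : Type} {r : Rule K X} (hf : Functional r)
    (σ : Subst K X) {y : X} (hy : VarOccurs y (r.2.subst σ)) : VarOccurs y (r.1.subst σ) := by
  obtain ⟨x, hx, hyx⟩ := Pattern.varOccurs_subst_iff.mp hy
  exact Pattern.varOccurs_subst_iff.mpr ⟨x, hf x hx, hyx⟩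

theorem ComposedBy.functional {K X : Type} {r₁ r₂ r : Rule K X} (h : ComposedBy r₁ r₂ r)
    (hf₁ : Functional r₁) (hf₂ : Functional r₂) : Functional r := by
  obtain ⟨σ₁, σ₂, ⟨hu, -⟩, rfl⟩ := h
  intro y hy
  have hy' := hf₂.varOccurs_subst σ₂ hy
  rw [← show r₁.2.subst σ₁ = r₂.1.subst σ₂ from hu] at hy'
  exact hf₁.varOccurs_subst σ₁ hy'

/-- The steps of a composite rule are the composites of the steps of its components. -/
theorem ComposedBy.step_iff {K X : Type} {r₁ r₂ r : Rule K X} (h : ComposedBy r₁ r₂ r)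
    (hf₂ : Functional r₂) {t₁ t₃ : Pattern K X} :
    Step r t₁ t₃ ↔ ∃ t₂, Step r₁ t₁ t₂ ∧ Step r₂ t₂ t₃ := by
  obtain ⟨σ₁, σ₂, ⟨hu, hmax⟩, rfl⟩ := h
  have hu' : r₁.2.subst σ₁ = r₂.1.subst σ₂ := hu
  constructor
  · rintro ⟨τ, rfl, rfl⟩
    refine ⟨(r₁.2.subst σ₁).subst τ, ⟨scomp τ σ₁, ?_, ?_⟩, ⟨scomp τ σ₂, ?_, ?_⟩⟩
    · exact Pattern.subst_scomp_s8 ..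
    · exact Pattern.subst_scomp_s8 ..
    · rw [Pattern.subst_scomp_s8, hu']
    · exact Pattern.subst_scomp_s8 ..
  · rintro ⟨t₂, ⟨α, rfl, hα⟩, ⟨β, hβ, rfl⟩⟩
    obtain ⟨⟨a, rfl⟩, ⟨b, rfl⟩⟩ := hmax α β (hα.trans hβ.symm)
    have hab : (r₂.1.subst σ₂).subst a = (r₂.1.subst σ₂).subst b := by
      rw [← Pattern.subst_scomp_s8 b, hβ, ← hα, Pattern.subst_scomp_s8, hu']
    refine ⟨a, (Pattern.subst_scomp_s8 ..).symm, ?_⟩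
    rw [Pattern.subst_scomp_s8]
    exact Pattern.subst_congr fun x hx =>
      Pattern.eq_of_subst_eq (hf₂.varOccurs_subst σ₂ hx) hab

theorem ruleEquiv_of_step_iff {K X : Type} {r r' : Rule K X}
    (h : ∀ t₁ t₂, Step r t₁ t₂ ↔ Step r' t₁ t₂) : RuleEquiv r r' := by
  have step_self (s : Rule K X) : Step s s.1 s.2 :=
    ⟨.var, Pattern.subst_id _, Pattern.subst_id _⟩
  obtain ⟨σ₁, h₁, h₁'⟩ := (h _ _).mpr (step_self r')
  obtain ⟨σ₂, h₂, h₂'⟩ := (h _ _).mp (step_self r)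
  exact ⟨σ₁, σ₂, h₁, h₁', h₂, h₂'⟩

theorem rule_composition_assoc {K X : Type} [Countable X] [Infinite X]
    (r₁ r₂ r₃ : Rule K X)
    (hf₁ : Functional r₁) (hf₂ : Functional r₂) (hf₃ : Functional r₃)
    (r₁₂ rL r₂₃ rR : Rule K X)
    (h₁₂ : ComposedBy r₁ r₂ r₁₂) (hL : ComposedBy r₁₂ r₃ rL)
    (h₂₃ : ComposedBy r₂ r₃ r₂₃) (hR : ComposedBy r₁ r₂₃ rR) :
    RuleEquiv rL rR := by
  apply ruleEquiv_of_step_iff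
  intro t₁ t₄
  rw [hL.step_iff hf₃, hR.step_iff (h₂₃.functional hf₂ hf₃)]
  simp only [h₁₂.step_iff hf₂, h₂₃.step_iff hf₃]
  constructor
  · rintro ⟨t₃, ⟨t₂, h₁, h₂⟩, h₃⟩
    exact ⟨t₂, h₁, t₃, h₂, h₃⟩
  · rintro ⟨t₂, h₁, t₃, h₂, h₃⟩
    exact ⟨t₃, ⟨t₂, h₁, h₂⟩, h₃⟩
end
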